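/- Suppose Conditions 2.1, 4.1 (with parameter θ₁) and 4.3 (with parameters θ₂, θ₃) are met. Then for any ω ∈ (0, min{ θ₁/(2(1−θ₁)), θ₂/(2(1−θ₂)), θ₃ − 1/2 }) and any sequence δ_n ↓ 0: sup_{u ∈ N(0, δ_n)} | C̄_n(u)/g_ω(u) | = o_P(1) as n → ∞. -/

import Mathlib

open MeasureTheory Filter Set
open scoped ENNReal NNReal

noncomputable section

namespace BBV

variable {Ω : Type*} [MeasurableSpace Ω] {E : Type*} [MeasurableSpace E] {d : ℕ}

/-- The real-valued indicator function of a set. -/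
def indic {α : Type*} (s : Set α) (x : α) : ℝ := s.indicator (fun _ => (1 : ℝ)) x

/-- `Z n = o_P(r n)`: convergence to zero in (outer) probability at rate `r`. -/
def oP (P : Measure Ω) (Z : ℕ → Ω → ℝ) (r : ℕ → ℝ) : Prop :=
  ∀ ε : ℝ, 0 < ε → Tendsto (fun n => P {ω | ε * r n < |Z n ω|}) atTop (nhds 0)

/-- `Z n = o_P(1)`: convergence to zero in (outer) probability. -/
def oP1 (P : Measure Ω) (Z : ℕ → Ω → ℝ) : Prop := oP P Z fun _ => 1

/-- `Z n = O_P(1)`: boundedness in (outer) probability. -/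
def bigOP (P : Measure Ω) (Z : ℕ → Ω → ℝ) : Prop :=
  ∀ ε : ℝ, 0 < ε → ∃ M : ℝ, ∀ᶠ n in atTop, P {ω | M < |Z n ω|} ≤ ENNReal.ofReal ε

/-- Strict stationarity of a two-sided sequence: all finite-dimensional distributions
are invariant under shifts. -/
def StrictlyStationary (P : Measure Ω) (X : ℤ → Ω → E) : Prop :=
  ∀ (m : ℕ) (idx : Fin m → ℤ) (k : ℤ),
    Measure.map (fun ω (p : Fin m) => X (idx p + k) ω) P =
      Measure.map (fun ω (p : Fin m) => X (idx p) ω) P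

/-- The sigma-field generated by the variables `X i`, `i ∈ S`. -/
def mixSigma (X : ℤ → Ω → E) (S : Set ℤ) : MeasurableSpace Ω :=
  ⨆ i ∈ S, MeasurableSpace.comap (X i) inferInstance

/-- The alpha-mixing coefficient of the sequence `X`. -/
def alphaMix (P : Measure Ω) (X : ℤ → Ω → E) (k : ℕ) : ℝ :=
  sSup {r : ℝ | ∃ (i : ℤ) (A B : Set Ω),
    MeasurableSet[mixSigma X (Set.Iic i)] A ∧
    MeasurableSet[mixSigma X (Set.Ici (i + (k : ℤ)))] B ∧
    r = |(P (A ∩ B)).toReal - (P A).toReal * (P B).toReal|}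

/-- Exponentially decaying alpha-mixing coefficients: `α(k) = O(a^k)` for some `a ∈ (0,1)`. -/
def ExpAlphaMixing (P : Measure Ω) (X : ℤ → Ω → E) : Prop :=
  ∃ a ∈ Set.Ioo (0 : ℝ) 1, ∃ c : ℝ, ∀ k : ℕ, 1 ≤ k → alphaMix P X k ≤ c * a ^ k

/-- Marginal c.d.f. `F_j` of the stationary sequence. -/
def margF (P : Measure Ω) (X : ℤ → Ω → Fin d → ℝ) (j : Fin d) (x : ℝ) : ℝ :=
  (P {ω | X 0 ω j ≤ x}).toReal

/-- `U_i = (F_1(X_{i1}),…,F_d(X_{id}))`. -/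
def Uv (P : Measure Ω) (X : ℤ → Ω → Fin d → ℝ) (i : ℤ) (ω : Ω) (j : Fin d) : ℝ :=
  margF P X j (X i ω j)

/-- The copula `C` of the stationary distribution, i.e. the c.d.f. of `U_0`. -/
def cop (P : Measure Ω) (X : ℤ → Ω → Fin d → ℝ) (u : Fin d → ℝ) : ℝ :=
  (P {ω | ∀ j, Uv P X 0 ω j ≤ u j}).toReal

/-- Empirical c.d.f. `G_n` of the (unobservable) sample `U_1,…,U_n`. -/
def Gn (P : Measure Ω) (X : ℤ → Ω → Fin d → ℝ) (n : ℕ) (u : Fin d → ℝ) (ω : Ω) : ℝ :=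
  (n : ℝ)⁻¹ * ∑ i ∈ Finset.Icc (1 : ℤ) (n : ℤ), indic {ω' | ∀ j, Uv P X i ω' j ≤ u j} ω

/-- The empirical process `α_n = √n (G_n − C)`. -/
def alphan (P : Measure Ω) (X : ℤ → Ω → Fin d → ℝ) (n : ℕ) (u : Fin d → ℝ) (ω : Ω) : ℝ :=
  Real.sqrt n * (Gn P X n u ω - cop P X u)

/-- Marginal empirical c.d.f. `G_{nj}` based on `U_{1j},…,U_{nj}`. -/
def Gnj (P : Measure Ω) (X : ℤ → Ω → Fin d → ℝ) (n : ℕ) (j : Fin d) (s : ℝ) (ω : Ω) : ℝ :=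
  (n : ℝ)⁻¹ * ∑ i ∈ Finset.Icc (1 : ℤ) (n : ℤ), indic {ω' | Uv P X i ω' j ≤ s} ω

/-- The marginal empirical process `α_{nj}(s) = √n (G_{nj}(s) − s)`. -/
def alphanj (P : Measure Ω) (X : ℤ → Ω → Fin d → ℝ) (n : ℕ) (j : Fin d) (s : ℝ) (ω : Ω) : ℝ :=
  Real.sqrt n * (Gnj P X n j s ω - s)

/-- Left-continuous generalized inverse: `H⁻(s) = inf{x : H(x) ≥ s}` for `s ≠ 0`,
and `H⁻(0) = sup{x : H(x) = 0}`. -/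
def genInv (H : ℝ → ℝ) (s : ℝ) : ℝ :=
  if s = 0 then sSup {x | H x = 0} else sInf {x | s ≤ H x}

/-- The marginal quantile process `β_{nj}(s) = √n (G_{nj}⁻(s) − s)`. -/
def betanj (P : Measure Ω) (X : ℤ → Ω → Fin d → ℝ) (n : ℕ) (j : Fin d) (s : ℝ) (ω : Ω) : ℝ :=
  Real.sqrt n * (genInv (fun x => Gnj P X n j x ω) s - s)

/-- Marginal empirical c.d.f. `F_{nj}` of the observations `X_{1j},…,X_{nj}`. -/
def empCdfX (X : ℤ → Ω → Fin d → ℝ) (n : ℕ) (j : Fin d) (x : ℝ) (ω : Ω) : ℝ :=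
  (n : ℝ)⁻¹ * ∑ i ∈ Finset.Icc (1 : ℤ) (n : ℤ), indic {ω' | X i ω' j ≤ x} ω

/-- Pseudo-observations `Û_{ij} = n/(n+1) · F_{nj}(X_{ij})`. -/
def pseudoObs (X : ℤ → Ω → Fin d → ℝ) (n : ℕ) (i : ℤ) (ω : Ω) (j : Fin d) : ℝ :=
  (n : ℝ) / ((n : ℝ) + 1) * empCdfX X n j (X i ω j) ω

/-- The empirical copula `Ĉ_n`. -/
def empCop (X : ℤ → Ω → Fin d → ℝ) (n : ℕ) (u : Fin d → ℝ) (ω : Ω) : ℝ :=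
  (n : ℝ)⁻¹ * ∑ i ∈ Finset.Icc (1 : ℤ) (n : ℤ), indic {ω' | ∀ j, pseudoObs X n i ω' j ≤ u j} ω

/-- The empirical copula process `ĈP_n = √n (Ĉ_n − C)`. -/
def hatCP (P : Measure Ω) (X : ℤ → Ω → Fin d → ℝ) (n : ℕ) (u : Fin d → ℝ) (ω : Ω) : ℝ :=
  Real.sqrt n * (empCop X n u ω - cop P X u)

/-- First-order partial derivative `Ċ_j` of `C`, defined everywhere as the limsup of
difference quotients (which coincides with the partial derivative wherever it exists). -/
def Cdot (C : (Fin d → ℝ) → ℝ) (j : Fin d) (u : Fin d → ℝ) : ℝ :=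
  Filter.limsup (fun h : ℝ => (C (Function.update u j (u j + h)) - C u) / h)
    (nhdsWithin 0 {(0 : ℝ)}ᶜ)

/-- The process `C̄_n(u) = α_n(u) − Σ_j Ċ_j(u) α_n(u^{(j)})`. -/
def Cbar (P : Measure Ω) (X : ℤ → Ω → Fin d → ℝ) (n : ℕ) (u : Fin d → ℝ) (ω : Ω) : ℝ :=
  alphan P X n u ω -
    ∑ j, Cdot (cop P X) j u * alphan P X n (Function.update (fun _ => (1 : ℝ)) j (u j)) ω

/-- `C_n(u) = G_n(G_{n1}⁻(u₁),…,G_{nd}⁻(u_d))`. -/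
def copGI (P : Measure Ω) (X : ℤ → Ω → Fin d → ℝ) (n : ℕ) (u : Fin d → ℝ) (ω : Ω) : ℝ :=
  Gn P X n (fun j => genInv (fun x => Gnj P X n j x ω) (u j)) ω

/-- The empirical copula process `𝔺_n = √n (C_n − C)` based on generalized inverses. -/
def CPgi (P : Measure Ω) (X : ℤ → Ω → Fin d → ℝ) (n : ℕ) (u : Fin d → ℝ) (ω : Ω) : ℝ :=
  Real.sqrt n * (copGI P X n u ω - cop P X u)

/-- `g₁(u) = min{ min_j u_j , min_j [1 − min_{k ≠ j} u_k] }`. -/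
def g1 (u : Fin d → ℝ) : ℝ :=
  min (⨅ j, u j) (⨅ j : Fin d, (1 - ⨅ k : {k : Fin d // k ≠ j}, u (k : Fin d)))

/-- The weight function `g_ω(u) = g₁(u)^ω`. -/
def gW (w : ℝ) (u : Fin d → ℝ) : ℝ := g1 u ^ w

/-- `g̃_ω(u) = g_ω(u) + 1{g_ω(u) = 0}`. -/
def gTilde (w : ℝ) (u : Fin d → ℝ) : ℝ := if gW w u = 0 then 1 else gW w u

/-- `N(a,b) = {u ∈ [0,1]^d : a < g₁(u) ≤ b}`. -/
def NN (d : ℕ) (a b : ℝ) : Set (Fin d → ℝ) :=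
  {u | (∀ j, 0 ≤ u j ∧ u j ≤ 1) ∧ a < g1 u ∧ g1 u ≤ b}

/-- `V_j = {u ∈ [0,1]^d : u_j ∈ (0,1)}`. -/
def VV (d : ℕ) (j : Fin d) : Set (Fin d → ℝ) :=
  {u | (∀ k, 0 ≤ u k ∧ u k ≤ 1) ∧ 0 < u j ∧ u j < 1}

/-- Condition 2.1: existence, continuity and growth bounds for the first and second
order partial derivatives of the copula `C`. -/
def Condition21 (C : (Fin d → ℝ) → ℝ) : Prop :=
  (∀ j : Fin d, ∀ u ∈ VV d j,
    HasDerivAt (fun t => C (Function.update u j t)) (Cdot C j u) (u j)) ∧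
  (∀ j : Fin d, ContinuousOn (Cdot C j) (VV d j)) ∧
  ∃ Cdd : Fin d → Fin d → (Fin d → ℝ) → ℝ,
    (∀ j₁ j₂ : Fin d, ∀ u ∈ VV d j₁ ∩ VV d j₂,
      HasDerivAt (fun t => Cdot C j₂ (Function.update u j₁ t)) (Cdd j₁ j₂ u) (u j₁)) ∧
    (∀ j₁ j₂ : Fin d, ContinuousOn (Cdd j₁ j₂) (VV d j₁ ∩ VV d j₂)) ∧
    ∃ K : ℝ, 0 < K ∧ ∀ j₁ j₂ : Fin d, ∀ u ∈ VV d j₁ ∩ VV d j₂,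
      |Cdd j₁ j₂ u| ≤ K * min (1 / (u j₁ * (1 - u j₁))) (1 / (u j₂ * (1 - u j₂)))

/-- The weighted modulus of continuity `M_n(δ,μ)` of the empirical process. -/
def Mn (P : Measure Ω) (X : ℤ → Ω → Fin d → ℝ) (n : ℕ) (δ μ : ℝ) (ω : Ω) : ℝ :=
  ⨆ q ∈ {q : (Fin d → ℝ) × (Fin d → ℝ) |
      q.1 ∈ Set.Icc 0 1 ∧ q.2 ∈ Set.Icc 0 1 ∧ dist q.1 q.2 ≤ δ},
    |alphan P X n q.1 ω - alphan P X n q.2 ω| / max (dist q.1 q.2 ^ μ) ((n : ℝ) ^ (-μ))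

/-- Condition 4.1 with parameter `θ₁`. -/
def Condition41 (P : Measure Ω) (X : ℤ → Ω → Fin d → ℝ) (θ₁ : ℝ) : Prop :=
  ∀ μ ∈ Set.Ioo (0 : ℝ) θ₁, ∀ δ : ℕ → ℝ, Tendsto δ atTop (nhds 0) →
    oP1 P (fun n ω => Mn P X n (δ n) μ ω)

/-- Condition 4.3 with parameters `θ₂, θ₃`. -/
def Condition43 (P : Measure Ω) (X : ℤ → Ω → Fin d → ℝ) (θ₂ θ₃ : ℝ) : Prop :=
  ∀ w ∈ Set.Ioo (0 : ℝ) θ₂, ∀ lam ∈ Set.Ioo (0 : ℝ) θ₃, ∀ j : Fin d,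
    bigOP P (fun n ω => ⨆ s ∈ Set.Ioo (0 : ℝ) 1,
      |alphanj P X n j s ω| / (s * (1 - s)) ^ w) ∧
    bigOP P (fun n ω => ⨆ s ∈ Set.Ioo ((n : ℝ) ^ (-lam)) (1 - (n : ℝ) ^ (-lam)),
      |betanj P X n j s ω| / (s * (1 - s)) ^ w)

/-- The probability integral transform for a continuous distribution function. -/
lemma measureReal_cdf_le (ν : Measure ℝ) [IsProbabilityMeasure ν] (F : ℝ → ℝ)
    (hF : ∀ x, F x = ν.real (Iic x)) (hFc : Continuous F) {s : ℝ} (hs : s ∈ Icc (0 : ℝ) 1) :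
    ν.real {x | F x ≤ s} = s := by
  have hcdf : F = ProbabilityTheory.cdf ν := by
    ext x
    rw [hF, ProbabilityTheory.cdf_eq_real]
  have hmono : Monotone F := hcdf ▸ ProbabilityTheory.monotone_cdf ν
  have hbot : Tendsto F atBot (nhds 0) := hcdf ▸ ProbabilityTheory.tendsto_cdf_atBot ν
  have htop : Tendsto F atTop (nhds 1) := hcdf ▸ ProbabilityTheory.tendsto_cdf_atTop ν
  rcases hs.2.eq_or_lt with rfl | hs1
  · have : {x | F x ≤ 1} = univ := by
      ext x
      simp [hF, measureReal_le_one]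
    simp [this]
  obtain ⟨z, hz⟩ := (htop.eventually (lt_mem_nhds hs1)).exists
  rcases Set.eq_empty_or_nonempty {x | F x ≤ s} with hA | hA
  · have h0 : s ≤ 0 := ge_of_tendsto' hbot fun x => by
      by_contra hx
      exact (hA ▸ (le_of_not_ge hx : x ∈ {x | F x ≤ s}) : x ∈ (∅ : Set ℝ))
    rw [hA, measureReal_empty]
    exact le_antisymm hs.1 h0
  have hbdd : BddAbove {x | F x ≤ s} := ⟨z, fun x hx => by
    by_contra hzx
    exact absurd (hmono (le_of_not_ge hzx)) (not_le.2 (lt_of_le_of_lt hx hz))⟩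
  have hcl : IsClosed {x | F x ≤ s} := isClosed_le hFc continuous_const
  have hmem : F (sSup {x | F x ≤ s}) ≤ s := hcl.csSup_mem hA hbdd
  have hIic : {x | F x ≤ s} = Iic (sSup {x | F x ≤ s}) := by
    ext x
    exact ⟨fun hx => le_csSup hbdd hx, fun hx => (hmono hx).trans hmem⟩
  obtain ⟨y, hy⟩ := mem_range_of_exists_le_of_exists_ge hFc hA ⟨z, hz.le⟩
  rw [hIic, ← hF]
  exact le_antisymm hmem (hy.symm.le.trans (hmono (le_csSup hbdd hy.le)))

section Distribution

variable {P : Measure Ω} {X : ℤ → Ω → Fin d → ℝ}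

lemma map_eq_of_stationary {Y : ℤ → Ω → E} (hmeas : ∀ i, Measurable (Y i))
    (hstat : StrictlyStationary P Y) (i : ℤ) :
    Measure.map (Y i) P = Measure.map (Y 0) P := by
  have h := congrArg (Measure.map fun f : Fin 1 → E => f 0) (hstat 1 (fun _ => 0) i)
  rw [Measure.map_map (measurable_pi_apply 0) (measurable_pi_lambda _ fun _ => hmeas _),
    Measure.map_map (measurable_pi_apply 0) (measurable_pi_lambda _ fun _ => hmeas _)] at h
  simpa [Function.comp_def] using h

lemma measureReal_Uv_le [IsProbabilityMeasure P] (hmeas : ∀ i, Measurable (X i))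
    (hstat : StrictlyStationary P X) (hcont : ∀ j, Continuous (margF P X j)) (i : ℤ) (j : Fin d)
    {s : ℝ} (hs : s ∈ Icc (0 : ℝ) 1) : P.real {ω | Uv P X i ω j ≤ s} = s := by
  have hm (k : ℤ) : Measurable fun ω => X k ω j := (measurable_pi_apply j).comp (hmeas k)
  have hlaw : Measure.map (fun ω => X i ω j) P = Measure.map (fun ω => X 0 ω j) P := by
    have h := congrArg (Measure.map fun x : Fin d → ℝ => x j) (map_eq_of_stationary hmeas hstat i)
    rwa [Measure.map_map (measurable_pi_apply j) (hmeas i),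
      Measure.map_map (measurable_pi_apply j) (hmeas 0)] at h
  have : IsProbabilityMeasure (Measure.map (fun ω => X 0 ω j) P) :=
    Measure.isProbabilityMeasure_map (hm 0).aemeasurable
  have hS : MeasurableSet {x | margF P X j x ≤ s} :=
    measurableSet_le (hcont j).measurable measurable_const
  have h := measureReal_cdf_le (Measure.map (fun ω => X 0 ω j) P) (margF P X j)
    (fun x => by rw [map_measureReal_apply (hm 0) measurableSet_Iic]; rfl) (hcont j) hs
  rwa [← hlaw, map_measureReal_apply (hm i) hS] at h

lemma measurableSet_Uv_le (hmeas : ∀ i, Measurable (X i)) (hcont : ∀ j, Continuous (margF P X j))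
    (i : ℤ) (j : Fin d) (s : ℝ) : MeasurableSet {ω | Uv P X i ω j ≤ s} :=
  measurableSet_le ((hcont j).measurable.comp ((measurable_pi_apply j).comp (hmeas i)))
    measurable_const

lemma Uv_le_one [IsProbabilityMeasure P] (i : ℤ) (ω : Ω) (j : Fin d) : Uv P X i ω j ≤ 1 :=
  measureReal_le_one

lemma ae_Uv_mem_Ioo [IsProbabilityMeasure P] (hmeas : ∀ i, Measurable (X i))
    (hstat : StrictlyStationary P X) (hcont : ∀ j, Continuous (margF P X j)) :
    ∀ᵐ ω ∂P, ∀ i j, Uv P X i ω j ∈ Ioo (0 : ℝ) 1 := by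
  refine ae_all_iff.2 fun i => ae_all_iff.2 fun j => ?_
  have hU {s : ℝ} (hs : s ∈ Icc (0 : ℝ) 1) := measureReal_Uv_le hmeas hstat hcont i j hs
  have h0 : ∀ᵐ ω ∂P, 0 < Uv P X i ω j := by
    have : P.real {ω | Uv P X i ω j ≤ 0} = 0 := hU ⟨le_rfl, zero_le_one⟩
    rw [measureReal_eq_zero_iff] at this
    rw [ae_iff]
    simpa using this
  have h1 : ∀ᵐ ω ∂P, Uv P X i ω j < 1 := by
    rw [ae_iff, ← measureReal_eq_zero_iff]
    refine le_antisymm (le_of_forall_pos_le_add fun ε hε => ?_) measureReal_nonneg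
    rcases le_total 1 ε with hε1 | hε1
    · exact measureReal_le_one.trans (by linarith)
    have hc := measureReal_compl (μ := P) (measurableSet_Uv_le hmeas hcont i j (1 - ε))
    rw [hU ⟨by linarith, by linarith⟩] at hc
    have hsub : {ω | ¬ Uv P X i ω j < 1} ⊆ {ω | Uv P X i ω j ≤ 1 - ε}ᶜ := fun ω hω => by
      simp only [mem_ofPred_eq, mem_compl_iff, not_lt, not_le] at hω ⊢
      linarith
    calc P.real {ω | ¬ Uv P X i ω j < 1} ≤ _ := measureReal_mono hsub
      _ = 0 + ε := by rw [hc]; simp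
  filter_upwards [h0, h1] with ω a b using ⟨a, b⟩

lemma cop_update_one [IsProbabilityMeasure P] (hmeas : ∀ i, Measurable (X i))
    (hstat : StrictlyStationary P X) (hcont : ∀ j, Continuous (margF P X j)) (j : Fin d)
    {s : ℝ} (hs : s ∈ Icc (0 : ℝ) 1) :
    cop P X (Function.update (fun _ => 1) j s) = s := by
  refine Eq.trans (congrArg P.real (Set.ext fun ω => ?_))
    (measureReal_Uv_le hmeas hstat hcont 0 j hs)
  refine ⟨fun h => by simpa using h j, fun h k => ?_⟩
  rcases eq_or_ne k j with rfl | hk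
  · simpa using h
  · simpa [hk] using Uv_le_one 0 ω k

lemma cop_mono [IsProbabilityMeasure P] {u v : Fin d → ℝ} (huv : u ≤ v) :
    cop P X u ≤ cop P X v :=
  measureReal_mono (μ := P) fun _ h j => (h j).trans (huv j)

lemma cop_sub_cop_le [IsProbabilityMeasure P] (hmeas : ∀ i, Measurable (X i))
    (hstat : StrictlyStationary P X) (hcont : ∀ j, Continuous (margF P X j)) {u v : Fin d → ℝ}
    (hu : ∀ j, u j ∈ Icc (0 : ℝ) 1) (hv : ∀ j, v j ∈ Icc (0 : ℝ) 1) (huv : u ≤ v) :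
    cop P X v - cop P X u ≤ ∑ j, (v j - u j) := by
  have hU (j : Fin d) : P.real ({ω | Uv P X 0 ω j ≤ v j} \ {ω | Uv P X 0 ω j ≤ u j})
      = v j - u j := by
    have hsub : {ω | Uv P X 0 ω j ≤ u j} ⊆ {ω | Uv P X 0 ω j ≤ v j} := fun ω h => h.trans (huv j)
    rw [measureReal_sdiff hsub
      (measurableSet_Uv_le hmeas hcont 0 j _), measureReal_Uv_le hmeas hstat hcont 0 j (hu j),
      measureReal_Uv_le hmeas hstat hcont 0 j (hv j)]
  have hsub : {ω | ∀ j, Uv P X 0 ω j ≤ v j} ⊆ {ω | ∀ j, Uv P X 0 ω j ≤ u j} ∪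
      ⋃ j, ({ω | Uv P X 0 ω j ≤ v j} \ {ω | Uv P X 0 ω j ≤ u j}) := fun ω hω => by
    by_cases h : ∀ j, Uv P X 0 ω j ≤ u j
    · exact Or.inl h
    · obtain ⟨j, hj⟩ := not_forall.1 h
      exact Or.inr (mem_iUnion.2 ⟨j, hω j, hj⟩)
  have h1 := (measureReal_mono (μ := P) hsub).trans (measureReal_union_le _ _)
  have h2 := measureReal_iUnion_fintype_le (μ := P)
    fun j => {ω | Uv P X 0 ω j ≤ v j} \ {ω | Uv P X 0 ω j ≤ u j}
  simp only [hU] at h2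
  have h3 : cop P X v ≤ cop P X u + _ := h1
  linarith

lemma cop_eq_zero [IsProbabilityMeasure P] (hmeas : ∀ i, Measurable (X i))
    (hstat : StrictlyStationary P X) (hcont : ∀ j, Continuous (margF P X j)) {u : Fin d → ℝ}
    {j : Fin d} (hu : u j = 0) : cop P X u = 0 := by
  refine le_antisymm ?_ measureReal_nonneg
  rw [← measureReal_Uv_le hmeas hstat hcont 0 j (left_mem_Icc.2 (zero_le_one' ℝ)), ← hu]
  exact measureReal_mono (μ := P) fun ω h => h j

end Distribution

section Derivatives

variable {C : (Fin d → ℝ) → ℝ}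

lemma update_mem_VV {u : Fin d → ℝ} {j k : Fin d} {t : ℝ} (hu : u ∈ VV d j) (hkj : k ≠ j)
    (ht : t ∈ Icc (0 : ℝ) 1) : Function.update u k t ∈ VV d j := by
  refine ⟨fun l => ?_, ?_⟩
  · rcases eq_or_ne l k with rfl | hl
    · simpa using ht
    · simpa [hl] using hu.1 l
  · simpa [hkj.symm] using hu.2

/-- On `V_j`, the partial derivative `Ċ_j` is Lipschitz in the remaining coordinates, with a
constant proportional to `1 / (u_j (1 - u_j))`. -/
lemma Condition21.exists_abs_Cdot_sub_le (hC : Condition21 C) :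
    ∃ K : ℝ, 0 < K ∧ ∀ (j : Fin d), ∀ u ∈ VV d j, ∀ v : Fin d → ℝ,
      (∀ k, v k ∈ Icc (0 : ℝ) 1) → v j = u j →
        |Cdot C j v - Cdot C j u| ≤ K / (u j * (1 - u j)) * ∑ k, |v k - u k| := by
  obtain ⟨-, hcont, Cdd, hderiv, -, K, hK, hbound⟩ := hC
  refine ⟨K, hK, fun j u hu v hv hvu => ?_⟩
  have hlt {x : Fin d → ℝ} (hx : x ∈ VV d j) {k : Fin d} (hkj : k ≠ j) {a b : ℝ} (ha : 0 ≤ a)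
      (hab : a < b) (hb : b ≤ 1) :
      |Cdot C j (Function.update x k b) - Cdot C j (Function.update x k a)| ≤
        K / (x j * (1 - x j)) * (b - a) := by
    obtain ⟨c, hc, hslope⟩ := exists_hasDerivAt_eq_slope
      (fun t => Cdot C j (Function.update x k t))
      (fun t => Cdd k j (Function.update x k t)) hab
      ((hcont j).comp (by fun_prop) fun t ht =>
        update_mem_VV hx hkj ⟨ha.trans ht.1, ht.2.trans hb⟩) (fun t ht => by
        have hmem : Function.update x k t ∈ VV d k ∩ VV d j :=
          ⟨⟨(update_mem_VV hx hkj ⟨ha.trans ht.1.le, ht.2.le.trans hb⟩).1, by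
            simpa using ⟨ha.trans_lt ht.1, ht.2.trans_le hb⟩⟩,
            update_mem_VV hx hkj ⟨ha.trans ht.1.le, ht.2.le.trans hb⟩⟩
        simpa using hderiv k j _ hmem)
    have hmem : Function.update x k c ∈ VV d k ∩ VV d j :=
      ⟨⟨(update_mem_VV hx hkj ⟨ha.trans hc.1.le, hc.2.le.trans hb⟩).1, by
        simpa using ⟨ha.trans_lt hc.1, hc.2.trans_le hb⟩⟩,
        update_mem_VV hx hkj ⟨ha.trans hc.1.le, hc.2.le.trans hb⟩⟩
    have h1 := (hbound k j _ hmem).trans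
      (mul_le_mul_of_nonneg_left (min_le_right _ _) hK.le)
    rw [eq_div_iff (sub_pos.2 hab).ne'] at hslope
    rw [← hslope, abs_mul, abs_of_pos (sub_pos.2 hab)]
    refine mul_le_mul_of_nonneg_right ?_ (sub_pos.2 hab).le
    simpa [hkj.symm, div_eq_mul_inv] using h1
  have hstep {x : Fin d → ℝ} (hx : x ∈ VV d j) {k : Fin d} (hkj : k ≠ j) {b : ℝ}
      (hb : b ∈ Icc (0 : ℝ) 1) :
      |Cdot C j (Function.update x k b) - Cdot C j x| ≤ K / (x j * (1 - x j)) * |b - x k| := by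
    rcases lt_trichotomy b (x k) with h | h | h
    · have := hlt hx hkj hb.1 h (hx.1 k).2
      rwa [Function.update_eq_self, abs_sub_comm, ← abs_of_pos (sub_pos.2 h),
        abs_sub_comm (x k)] at this
    · simp [h]
    · have := hlt hx hkj (hx.1 k).1 h hb.2
      rwa [Function.update_eq_self, ← abs_of_pos (sub_pos.2 h)] at this
  have hpw (S : Finset (Fin d)) : S.piecewise v u j = u j := by
    by_cases h : j ∈ S <;> simp [h, hvu]
  have hpwV (S : Finset (Fin d)) : S.piecewise v u ∈ VV d j := by
    refine ⟨fun k => ?_, by simpa only [hpw] using hu.2⟩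
    by_cases h : k ∈ S
    · simpa [h] using hv k
    · simpa [h] using hu.1 k
  have key (S : Finset (Fin d)) : |Cdot C j (S.piecewise v u) - Cdot C j u| ≤
      K / (u j * (1 - u j)) * ∑ k ∈ S, |v k - u k| := by
    induction S using Finset.induction_on with
    | empty => simp
    | insert k S hk ih =>
      rw [Finset.sum_insert hk, mul_add, Finset.piecewise_insert]
      refine (abs_sub_le _ (Cdot C j (S.piecewise v u)) _).trans (add_le_add ?_ ih)
      rcases eq_or_ne k j with rfl | hkj
      · rw [hvu, ← hpw S, Function.update_eq_self]
        simp
      · simpa only [hpw, Finset.piecewise_eq_of_notMem _ _ _ hk] using hstep (hpwV S) hkj (hv k)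
  simpa using key Finset.univ

end Derivatives

section Copula

variable {P : Measure Ω} {X : ℤ → Ω → Fin d → ℝ}

lemma abs_Cdot_cop_le_one [IsProbabilityMeasure P] (hmeas : ∀ i, Measurable (X i))
    (hstat : StrictlyStationary P X) (hcont : ∀ j, Continuous (margF P X j))
    (hC : Condition21 (cop P X)) {j : Fin d} {u : Fin d → ℝ} (hu : u ∈ VV d j) :
    |Cdot (cop P X) j u| ≤ 1 := by
  have hbox {t : ℝ} (ht : t ∈ Icc (0 : ℝ) 1) (k : Fin d) :
      Function.update u j t k ∈ Icc (0 : ℝ) 1 := by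
    rcases eq_or_ne k j with rfl | hk
    · simpa using ht
    · simpa [hk] using hu.1 k
  have hle {s t : ℝ} (hs : 0 ≤ s) (hst : s ≤ t) (ht : t ≤ 1) :
      |cop P X (Function.update u j t) - cop P X (Function.update u j s)| ≤ t - s := by
    have hst' : Function.update u j s ≤ Function.update u j t := by
      simpa using hst
    rw [abs_of_nonneg (sub_nonneg.2 (cop_mono hst'))]
    refine (cop_sub_cop_le hmeas hstat hcont (hbox ⟨hs, hst.trans ht⟩)
      (hbox ⟨hs.trans hst, ht⟩) hst').trans_eq ?_
    rw [Finset.sum_eq_single j (fun k _ hk => by simp [hk]) (by simp)]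
    simp
  refine (hC.1 j u hu).le_of_lip' zero_le_one ?_
  filter_upwards [Ioo_mem_nhds hu.2.1 hu.2.2] with t ht
  rw [one_mul, Real.norm_eq_abs, Real.norm_eq_abs]
  rcases le_total t (u j) with h | h
  · rw [abs_sub_comm, abs_sub_comm t, abs_of_nonneg (sub_nonneg.2 h)]
    exact hle ht.1.le h hu.2.2.le
  · rw [abs_of_nonneg (sub_nonneg.2 h)]
    exact hle hu.2.1.le h ht.2.le

lemma Cdot_cop_eq_zero [IsProbabilityMeasure P] (hmeas : ∀ i, Measurable (X i))
    (hstat : StrictlyStationary P X) (hcont : ∀ j, Continuous (margF P X j))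
    (hC : Condition21 (cop P X)) {j k : Fin d} (hjk : j ≠ k) {u : Fin d → ℝ} (hu : u ∈ VV d k)
    (huj : u j = 0) : Cdot (cop P X) k u = 0 := by
  refine (hC.1 k u hu).unique ((hasDerivAt_const (u k) (0 : ℝ)).congr_of_eventuallyEq ?_)
  exact Eventually.of_forall fun t => cop_eq_zero hmeas hstat hcont (j := j) (by simp [hjk, huj])

lemma Cdot_cop_update_one [IsProbabilityMeasure P] (hmeas : ∀ i, Measurable (X i))
    (hstat : StrictlyStationary P X) (hcont : ∀ j, Continuous (margF P X j))
    (hC : Condition21 (cop P X)) {j : Fin d} {s : ℝ} (hs : s ∈ Ioo (0 : ℝ) 1) :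
    Cdot (cop P X) j (Function.update (fun _ => 1) j s) = 1 := by
  have hV : Function.update (fun _ => (1 : ℝ)) j s ∈ VV d j := by
    refine ⟨fun k => ?_, by simpa using hs⟩
    rcases eq_or_ne k j with rfl | hk
    · simpa using ⟨hs.1.le, hs.2.le⟩
    · simp [hk]
  refine (hC.1 j _ hV).unique ((hasDerivAt_id _).congr_of_eventuallyEq ?_)
  simp only [Function.update_self, Function.update_idem]
  filter_upwards [Ioo_mem_nhds hs.1 hs.2] with t ht
  exact cop_update_one hmeas hstat hcont j ⟨ht.1.le, ht.2.le⟩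

end Copula

section Empirical

variable {P : Measure Ω} {X : ℤ → Ω → Fin d → ℝ}

lemma indic_setOf {α : Type*} (p : α → Prop) [DecidablePred p] (x : α) :
    indic {y | p y} x = if p x then 1 else 0 := by
  simp [indic, Set.indicator]

lemma Gn_mono {u v : Fin d → ℝ} (huv : u ≤ v) (n : ℕ) (ω : Ω) :
    Gn P X n u ω ≤ Gn P X n v ω := by
  classical
  refine mul_le_mul_of_nonneg_left (Finset.sum_le_sum fun i _ => ?_) (by positivity)
  simp only [indic_setOf]
  by_cases h : ∀ j, Uv P X i ω j ≤ u j
  · rw [if_pos h, if_pos fun j => (h j).trans (huv j)]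
  · rw [if_neg h]
    positivity

lemma Gn_sub_Gn_le {u v : Fin d → ℝ} (huv : u ≤ v) (n : ℕ) (ω : Ω) :
    Gn P X n v ω - Gn P X n u ω ≤ ∑ j, (Gnj P X n j (v j) ω - Gnj P X n j (u j) ω) := by
  classical
  simp only [Gn, Gnj, ← mul_sub, ← Finset.sum_sub_distrib, ← Finset.mul_sum]
  rw [Finset.sum_comm]
  refine mul_le_mul_of_nonneg_left (Finset.sum_le_sum fun i _ => ?_) (by positivity)
  simp only [indic_setOf]
  have hnonneg (j : Fin d) : (0 : ℝ) ≤ (if Uv P X i ω j ≤ v j then 1 else 0) -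
      (if Uv P X i ω j ≤ u j then 1 else 0) := by
    by_cases h : Uv P X i ω j ≤ u j
    · simp [h, h.trans (huv j)]
    · simp only [h, if_false, sub_zero]
      positivity
  by_cases hu : ∀ j, Uv P X i ω j ≤ u j
  · rw [if_pos hu, if_pos fun j => (hu j).trans (huv j), sub_self]
    exact Finset.sum_nonneg fun j _ => hnonneg j
  · rw [if_neg hu, sub_zero]
    split_ifs with hv
    · obtain ⟨j, hj⟩ := not_forall.1 hu
      refine le_trans ?_ (Finset.single_le_sum (fun j _ => hnonneg j) (Finset.mem_univ j))
      simp [hv j, hj]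
    · exact Finset.sum_nonneg fun j _ => hnonneg j

lemma alphan_sub_le [IsProbabilityMeasure P] (hmeas : ∀ i, Measurable (X i))
    (hstat : StrictlyStationary P X) (hcont : ∀ j, Continuous (margF P X j)) {u v : Fin d → ℝ}
    (hu : ∀ j, u j ∈ Icc (0 : ℝ) 1) (hv : ∀ j, v j ∈ Icc (0 : ℝ) 1) (huv : u ≤ v) (n : ℕ)
    (ω : Ω) : |alphan P X n v ω - alphan P X n u ω| ≤
      ∑ j, (|alphanj P X n j (v j) ω - alphanj P X n j (u j) ω| +
        Real.sqrt n * (v j - u j)) := by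
  have h1 := sub_nonneg.2 (Gn_mono (P := P) (X := X) huv n ω)
  have h2 := Gn_sub_Gn_le (P := P) (X := X) huv n ω
  have h3 := sub_nonneg.2 (cop_mono (P := P) (X := X) huv)
  have h4 := cop_sub_cop_le hmeas hstat hcont hu hv huv
  have hs : 0 ≤ Real.sqrt n := Real.sqrt_nonneg _
  have h5 : Real.sqrt n * ∑ j, (Gnj P X n j (v j) ω - Gnj P X n j (u j) ω) ≤
      ∑ j, (|alphanj P X n j (v j) ω - alphanj P X n j (u j) ω| +
        Real.sqrt n * (v j - u j)) := by
    rw [Finset.mul_sum]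
    refine Finset.sum_le_sum fun j _ => ?_
    have := le_abs_self (alphanj P X n j (v j) ω - alphanj P X n j (u j) ω)
    simp only [alphanj] at this ⊢
    linarith
  have h6 : Real.sqrt n * ∑ j, (v j - u j) ≤
      ∑ j, (|alphanj P X n j (v j) ω - alphanj P X n j (u j) ω| +
        Real.sqrt n * (v j - u j)) := by
    rw [Finset.mul_sum]
    exact Finset.sum_le_sum fun j _ => le_add_of_nonneg_left (abs_nonneg _)
  have h7 : alphan P X n v ω - alphan P X n u ω =
      Real.sqrt n * (Gn P X n v ω - Gn P X n u ω) -
        Real.sqrt n * (cop P X v - cop P X u) := by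
    simp only [alphan]
    ring
  have h8 := mul_nonneg hs h1
  have h9 := mul_nonneg hs h3
  have h10 := mul_le_mul_of_nonneg_left h2 hs
  have h11 := mul_le_mul_of_nonneg_left h4 hs
  rw [h7, abs_le]
  constructor <;> linarith

lemma alphan_update_one [IsProbabilityMeasure P] (hmeas : ∀ i, Measurable (X i))
    (hstat : StrictlyStationary P X) (hcont : ∀ j, Continuous (margF P X j)) (n : ℕ) (j : Fin d)
    {s : ℝ} (hs : s ∈ Icc (0 : ℝ) 1) (ω : Ω) :
    alphan P X n (Function.update (fun _ => 1) j s) ω = alphanj P X n j s ω := by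
  classical
  rw [alphan, alphanj, cop_update_one hmeas hstat hcont j hs, Gn, Gnj]
  congr 3
  refine Finset.sum_congr rfl fun i _ => ?_
  simp only [indic_setOf]
  refine if_congr ⟨fun h => by simpa using h j, fun h k => ?_⟩ rfl rfl
  rcases eq_or_ne k j with rfl | hk
  · simpa using h
  · simpa [hk] using Uv_le_one i ω k

lemma alphan_eq_zero [IsProbabilityMeasure P] (hmeas : ∀ i, Measurable (X i))
    (hstat : StrictlyStationary P X) (hcont : ∀ j, Continuous (margF P X j)) (n : ℕ)
    {ω : Ω} (hω : ∀ i j, Uv P X i ω j ∈ Ioo (0 : ℝ) 1) {u : Fin d → ℝ} {j : Fin d}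
    (hu : u j = 0) : alphan P X n u ω = 0 := by
  classical
  rw [alphan, cop_eq_zero hmeas hstat hcont hu, Gn, Finset.sum_eq_zero]
  · simp
  · intro i _
    rw [indic_setOf, if_neg fun h => ?_]
    exact absurd (hu ▸ h j) (not_le.2 (hω i j).1)

/-- On the event that all observations lie in `(0, 1)`, the marginal empirical process is tied
down linearly at both endpoints. -/
lemma exists_abs_alphanj_le {n : ℕ} (hn : n ≠ 0) {ω : Ω}
    (hω : ∀ i j, Uv P X i ω j ∈ Ioo (0 : ℝ) 1) (j : Fin d) :
    ∃ B : ℝ, 0 ≤ B ∧ ∀ s ∈ Icc (0 : ℝ) 1, |alphanj P X n j s ω| ≤ B * (s * (1 - s)) := by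
  classical
  have hv (i : ℤ) : 0 < Uv P X i ω j * (1 - Uv P X i ω j) :=
    mul_pos (hω i j).1 (sub_pos.2 (hω i j).2)
  refine ⟨Real.sqrt n * ((n : ℝ)⁻¹ *
    ∑ i ∈ Finset.Icc (1 : ℤ) n, (Uv P X i ω j * (1 - Uv P X i ω j))⁻¹), ?_, fun s hs => ?_⟩
  · have := fun i => (inv_pos.2 (hv i)).le
    have := Finset.sum_nonneg (s := Finset.Icc (1 : ℤ) n) fun i _ => this i
    positivity
  have hn' : (n : ℝ) ≠ 0 := Nat.cast_ne_zero.2 hn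
  have hsum : Gnj P X n j s ω - s = (n : ℝ)⁻¹ *
      ∑ i ∈ Finset.Icc (1 : ℤ) n, ((if Uv P X i ω j ≤ s then 1 else 0) - s) := by
    simp only [Gnj, indic_setOf, Finset.sum_sub_distrib, Finset.sum_const, Int.card_Icc,
      nsmul_eq_mul, mul_sub]
    simp [hn']
  rw [alphanj, hsum, abs_mul, abs_mul, abs_of_nonneg (Real.sqrt_nonneg _),
    abs_of_nonneg (by positivity : (0 : ℝ) ≤ (n : ℝ)⁻¹), mul_assoc, mul_assoc, Finset.sum_mul]
  gcongr
  refine (Finset.abs_sum_le_sum_abs _ _).trans (Finset.sum_le_sum fun i _ => ?_)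
  rw [inv_mul_eq_div, le_div_iff₀ (hv i)]
  obtain ⟨h0, h1⟩ := hω i j
  split_ifs with h
  · rw [abs_of_nonneg (by linarith [hs.2])]
    have : Uv P X i ω j * (1 - Uv P X i ω j) ≤ s := by nlinarith
    nlinarith [hs.2]
  · have h := not_le.1 h
    rw [zero_sub, abs_neg, abs_of_nonneg hs.1]
    have : Uv P X i ω j * (1 - Uv P X i ω j) ≤ 1 - s := by nlinarith
    nlinarith [hs.1]

lemma abs_alphan_le [IsProbabilityMeasure P] (n : ℕ) (u : Fin d → ℝ) (ω : Ω) :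
    |alphan P X n u ω| ≤ Real.sqrt n := by
  classical
  have hG0 : 0 ≤ Gn P X n u ω := by
    refine mul_nonneg (by positivity) (Finset.sum_nonneg fun i _ => ?_)
    rw [indic_setOf]
    positivity
  have hG1 : Gn P X n u ω ≤ 1 := by
    have : ∑ i ∈ Finset.Icc (1 : ℤ) n, indic {ω' | ∀ j, Uv P X i ω' j ≤ u j} ω ≤ n := by
      refine (Finset.sum_le_card_nsmul _ _ 1 fun i _ => ?_).trans_eq (by simp)
      rw [indic_setOf]
      split_ifs <;> norm_num
    exact inv_mul_le_one_of_le₀ this (by positivity)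
  have hC0 : 0 ≤ cop P X u := measureReal_nonneg
  have hC1 : cop P X u ≤ 1 := measureReal_le_one
  rw [alphan, abs_mul, abs_of_nonneg (Real.sqrt_nonneg _)]
  exact mul_le_of_le_one_right (Real.sqrt_nonneg _) (abs_le.2 ⟨by linarith, by linarith⟩)

end Empirical

section Boundary

lemma g1_le {u : Fin d → ℝ} (k : Fin d) : g1 u ≤ u k :=
  (min_le_left _ _).trans (ciInf_le (finite_range _).bddBelow k)

lemma exists_eq_g1_or_exists_one_sub_le_g1 (hd : 0 < d) (u : Fin d → ℝ) :
    (∃ j, u j = g1 u) ∨ ∃ j, ∀ k, k ≠ j → 1 - u k ≤ g1 u := by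
  have : Nonempty (Fin d) := ⟨⟨0, hd⟩⟩
  rcases min_choice (⨅ j, u j) (⨅ j : Fin d, (1 - ⨅ k : {k : Fin d // k ≠ j}, u (k : Fin d)))
    with h | h
  · obtain ⟨j, hj⟩ := exists_eq_ciInf_of_finite (f := u)
    exact Or.inl ⟨j, by rw [g1, h, hj]⟩
  · obtain ⟨j, hj⟩ := exists_eq_ciInf_of_finite
      (f := fun j : Fin d => (1 - ⨅ k : {k : Fin d // k ≠ j}, u (k : Fin d)))
    refine Or.inr ⟨j, fun k hk => ?_⟩
    rw [g1, h, ← hj]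
    have := ciInf_le (finite_range fun k : {k : Fin d // k ≠ j} => u k).bddBelow ⟨k, hk⟩
    linarith

variable {P : Measure Ω} {X : ℤ → Ω → Fin d → ℝ}

lemma alphanj_eq_zero {n : ℕ} (hn : n ≠ 0) {ω : Ω} (hω : ∀ i j, Uv P X i ω j ∈ Ioo (0 : ℝ) 1)
    {j : Fin d} {s : ℝ} (hs : s = 0 ∨ s = 1) : alphanj P X n j s ω = 0 := by
  obtain ⟨B, -, hB⟩ := exists_abs_alphanj_le hn hω j
  rcases hs with rfl | rfl
  · simpa using hB 0 (by simp)
  · simpa using hB 1 (by simp)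

/-- Every point `u` with `g₁(u) > 0` has a neighbour `v` at distance at most `g₁(u)` at which
`C̄_n` vanishes, in the sense that `α_n(v)` is a linear combination of the marginal processes whose
coefficients are close to the partial derivatives of the copula at `u`. -/
lemma exists_boundary_point [IsProbabilityMeasure P] (hd : 0 < d) (hmeas : ∀ i, Measurable (X i))
    (hstat : StrictlyStationary P X) (hcont : ∀ j, Continuous (margF P X j))
    (hC : Condition21 (cop P X)) :
    ∃ A : ℝ, 0 < A ∧ ∀ u : Fin d → ℝ, (∀ j, u j ∈ Icc (0 : ℝ) 1) → 0 < g1 u →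
      ∃ v c : Fin d → ℝ, (∀ j, v j ∈ Icc (0 : ℝ) 1) ∧ (v ≤ u ∨ u ≤ v) ∧
        (∀ k, |u k - v k| ≤ g1 u) ∧ (∀ k, v k = u k ∨ v k = 0 ∨ v k = 1) ∧
        (∀ n : ℕ, ∀ ω, (∀ i j, Uv P X i ω j ∈ Ioo (0 : ℝ) 1) →
          alphan P X n v ω = ∑ k, c k * alphanj P X n k (u k) ω) ∧
        ∀ k, u k < 1 → |Cdot (cop P X) k u - c k| ≤ 2 ∧
          |Cdot (cop P X) k u - c k| * (u k * (1 - u k)) ≤ A * g1 u := by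
  obtain ⟨K, hK, hlip⟩ := hC.exists_abs_Cdot_sub_le
  refine ⟨K * d + 1, by positivity, fun u hu hg => ?_⟩
  have hpos (k : Fin d) : 0 < u k := hg.trans_le (g1_le k)
  have hV {k : Fin d} (hk : u k < 1) : u ∈ VV d k := ⟨hu, hpos k, hk⟩
  have hone {k : Fin d} (hk : u k < 1) := abs_Cdot_cop_le_one hmeas hstat hcont hC (hV hk)
  have hdiff {v : Fin d → ℝ} (hv : ∀ j, v j ∈ Icc (0 : ℝ) 1) (hd : ∀ k, |u k - v k| ≤ g1 u)
      {k : Fin d} (hk : u k < 1) (hvk : v k = u k) :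
      |Cdot (cop P X) k u - Cdot (cop P X) k v| * (u k * (1 - u k)) ≤ (K * d + 1) * g1 u := by
    have hpk : 0 < u k * (1 - u k) := mul_pos (hpos k) (sub_pos.2 hk)
    have h := hlip k u (hV hk) v hv hvk
    rw [div_mul_eq_mul_div, le_div_iff₀ hpk, abs_sub_comm] at h
    have hsum : ∑ k, |v k - u k| ≤ d * g1 u := by
      refine (Finset.sum_le_card_nsmul _ _ (g1 u) fun k _ => ?_).trans_eq (by simp)
      rw [abs_sub_comm]
      exact hd k
    nlinarith
  have htriv {k : Fin d} (hk : u k < 1) (h : u k * (1 - u k) ≤ g1 u) :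
      |Cdot (cop P X) k u - 0| ≤ 2 ∧
        |Cdot (cop P X) k u - 0| * (u k * (1 - u k)) ≤ (K * d + 1) * g1 u := by
    have h1 := hone hk
    have h2 : 0 < u k * (1 - u k) := mul_pos (hpos k) (sub_pos.2 hk)
    have h3 : 0 ≤ K * d * g1 u := by positivity
    rw [sub_zero]
    exact ⟨by linarith, by nlinarith⟩
  rcases exists_eq_g1_or_exists_one_sub_le_g1 hd u with ⟨j, hj⟩ | ⟨j, hj⟩
  · have hv (k : Fin d) : Function.update u j 0 k ∈ Icc (0 : ℝ) 1 := by
      rcases eq_or_ne k j with rfl | hk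
      · simp
      · simpa [hk] using hu k
    have hdist (k : Fin d) : |u k - Function.update u j 0 k| ≤ g1 u := by
      rcases eq_or_ne k j with rfl | hk
      · simp [hj, abs_of_pos hg]
      · simp [hk, hg.le]
    refine ⟨Function.update u j 0, 0, hv, Or.inl ?_, hdist, fun k => ?_, fun n ω hω => ?_,
      fun k hk => ?_⟩
    · simpa using (hpos j).le
    · rcases eq_or_ne k j with rfl | hk <;> simp [*]
    · simpa using alphan_eq_zero hmeas hstat hcont n hω (j := j) (by simp)
    · rcases eq_or_ne k j with rfl | hkj
      · exact htriv hk (by nlinarith [hpos k])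
      · have hVk := update_mem_VV (hV hk) hkj.symm (left_mem_Icc.2 (zero_le_one' ℝ))
        have h0 := Cdot_cop_eq_zero hmeas hstat hcont hC hkj.symm hVk (by simp)
        refine ⟨?_, ?_⟩
        · simpa using (hone hk).trans one_le_two
        · rw [Pi.zero_apply, ← h0]
          exact hdiff hv hdist hk (by simp [hkj])
  · have hv (k : Fin d) : Function.update (fun _ => (1 : ℝ)) j (u j) k ∈ Icc (0 : ℝ) 1 := by
      rcases eq_or_ne k j with rfl | hk
      · simpa using hu k
      · simp [hk]
    have hdist (k : Fin d) : |u k - Function.update (fun _ => (1 : ℝ)) j (u j) k| ≤ g1 u := by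
      rcases eq_or_ne k j with rfl | hk
      · simp [hg.le]
      · rw [abs_sub_comm]
        simpa [hk, abs_of_nonneg (sub_nonneg.2 (hu k).2)] using hj k hk
    refine ⟨Function.update (fun _ => 1) j (u j), Pi.single j 1, hv, Or.inr ?_, hdist, fun k => ?_,
      fun n ω hω => ?_, fun k hk => ?_⟩
    · intro k
      rcases eq_or_ne k j with rfl | hk
      · simp
      · simpa [hk] using (hu k).2
    · rcases eq_or_ne k j with rfl | hk <;> simp [*]
    · rw [alphan_update_one hmeas hstat hcont n j (hu j)]
      simp [Pi.single_apply]
    · rcases eq_or_ne k j with rfl | hkj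
      · have h1 := Cdot_cop_update_one hmeas hstat hcont hC (j := k) ⟨hpos k, hk⟩
        refine ⟨?_, ?_⟩
        · have := abs_le.1 (hone hk)
          rw [Pi.single_eq_same, abs_le]
          constructor <;> linarith
        · rw [Pi.single_eq_same]
          simpa only [h1] using hdiff hv hdist hk (by simp)
      · rw [Pi.single_eq_of_ne hkj]
        refine htriv hk ?_
        nlinarith [hj k hkj, (hu k).2]

end Boundary

section Estimate

lemma mul_rpow_le_of_mul_le {x v s a A : ℝ} (hs : 0 < s) (hv : 0 < v) (ha0 : 0 ≤ a)
    (ha1 : a ≤ 1) (hA : 0 ≤ A) (hx2 : x ≤ 2) (hxA : x * v ≤ A * s) :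
    x * v ^ a ≤ (A + 2) * s ^ a := by
  have hsa := Real.rpow_pos_of_pos hs a
  have hva := Real.rpow_pos_of_pos hv a
  rcases le_total v s with h | h
  · have := Real.rpow_le_rpow hv.le h ha0
    nlinarith
  · have h1 := Real.rpow_le_rpow hs.le h (sub_nonneg.2 ha1)
    have hs' : s = s ^ a * s ^ (1 - a) := by rw [← Real.rpow_add hs]; simp
    have hv' : v = v ^ a * v ^ (1 - a) := by rw [← Real.rpow_add hv]; simp
    have hb := Real.rpow_pos_of_pos hv (1 - a)
    have h2 : x * v ^ a * v ^ (1 - a) ≤ A * s ^ a * v ^ (1 - a) := by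
      calc x * v ^ a * v ^ (1 - a) = x * v := by rw [mul_assoc, ← hv']
        _ ≤ A * s := hxA
        _ = A * s ^ a * s ^ (1 - a) := by rw [mul_assoc, ← hs']
        _ ≤ A * s ^ a * v ^ (1 - a) := by gcongr
    have := le_of_mul_le_mul_right h2 hb
    linarith

lemma sqrt_mul_le_rpow {n : ℕ} {s a : ℝ} (hs : 0 < s) (hs1 : s ≤ 1) (hns : n * s ≤ 1)
    (ha : a ≤ 1 / 2) : Real.sqrt n * s ≤ s ^ a := by
  calc Real.sqrt n * s = Real.sqrt (n * s) * Real.sqrt s := by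
        rw [Real.sqrt_mul (by positivity), mul_assoc, Real.mul_self_sqrt hs.le]
    _ ≤ 1 * Real.sqrt s := by
        gcongr
        exact Real.sqrt_le_one.2 hns
    _ = s ^ (1 / 2 : ℝ) := by rw [one_mul, Real.sqrt_eq_rpow]
    _ ≤ s ^ a := Real.rpow_le_rpow_of_exponent_ge hs hs1 ha

variable {P : Measure Ω} {X : ℤ → Ω → Fin d → ℝ}

lemma exists_abs_Cbar_div_le [IsProbabilityMeasure P] (hd : 0 < d) (hmeas : ∀ i, Measurable (X i))
    (hstat : StrictlyStationary P X) (hcont : ∀ j, Continuous (margF P X j))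
    (hC : Condition21 (cop P X)) {w a μ M : ℝ} (hw : 0 < w) (hwa : w < a) (ha : a ≤ 1 / 2)
    (hwμ : w < μ) (hM : 0 ≤ M) :
    ∃ B : ℝ, 0 ≤ B ∧ ∀ (n : ℕ) (δ ε : ℝ) (ω : Ω), n ≠ 0 → 0 ≤ ε →
      (∀ i j, Uv P X i ω j ∈ Ioo (0 : ℝ) 1) →
      (∀ j, ∀ s ∈ Ioo (0 : ℝ) 1, |alphanj P X n j s ω| ≤ M * (s * (1 - s)) ^ a) →
      (∀ p q : Fin d → ℝ, p ∈ Icc 0 1 → q ∈ Icc 0 1 → dist p q ≤ δ →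
        |alphan P X n p ω - alphan P X n q ω| ≤ ε * max (dist p q ^ μ) ((n : ℝ) ^ (-μ))) →
      ∀ u ∈ NN d 0 δ, |Cbar P X n u ω / gW w u| ≤ ε + B * δ ^ (a - w) := by
  obtain ⟨A, hA, hbdry⟩ := exists_boundary_point hd hmeas hstat hcont hC
  refine ⟨d * (M + 1) + d * (M * (A + 2)), by positivity,
    fun n δ ε ω hn hε hω hmarg hmod u ⟨hu, hg, hgδ⟩ => ?_⟩
  obtain ⟨v, c, hv, huv, hdist, hvk, hlin, hcoef⟩ := hbdry u hu hg
  set s := g1 u with hs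
  have hpos (k : Fin d) : 0 < u k := hg.trans_le (g1_le k)
  have hs1 : s ≤ 1 := (g1_le ⟨0, hd⟩).trans (hu _).2
  have hsa := Real.rpow_pos_of_pos hg a
  have hsw := Real.rpow_pos_of_pos hg w
  have hinc : |alphan P X n u ω - alphan P X n v ω| ≤ ε * s ^ w + d * (M + 1) * s ^ a := by
    rcases le_total 1 (n * s) with hns | hns
    · have hd' : dist u v ≤ s := (dist_pi_le_iff hg.le).2 hdist
      have hbox {p : Fin d → ℝ} (hp : ∀ j, p j ∈ Icc (0 : ℝ) 1) : p ∈ Icc (0 : Fin d → ℝ) 1 :=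
        ⟨fun j => (hp j).1, fun j => (hp j).2⟩
      refine (hmod u v (hbox hu) (hbox hv) (hd'.trans hgδ)).trans ?_
      have hmax : max (dist u v ^ μ) ((n : ℝ) ^ (-μ)) ≤ s ^ w := by
        refine le_trans (max_le (Real.rpow_le_rpow dist_nonneg hd' (hw.trans hwμ).le) ?_)
          (Real.rpow_le_rpow_of_exponent_ge hg hs1 hwμ.le)
        rw [Real.rpow_neg (by positivity), ← Real.inv_rpow (by positivity)]
        refine Real.rpow_le_rpow (by positivity) ?_ (hw.trans hwμ).le
        rw [inv_le_iff_one_le_mul₀ (by positivity)]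
        linarith
      have : 0 ≤ d * (M + 1) * s ^ a := by positivity
      nlinarith
    · have h1 : |alphan P X n u ω - alphan P X n v ω| ≤
          ∑ k, (|alphanj P X n k (u k) ω - alphanj P X n k (v k) ω| +
            Real.sqrt n * |u k - v k|) := by
        rcases huv with h | h
        · refine (alphan_sub_le hmeas hstat hcont hv hu h n ω).trans_eq ?_
          simp only [abs_of_nonneg (sub_nonneg.2 (h _))]
        · rw [abs_sub_comm]
          refine (alphan_sub_le hmeas hstat hcont hu hv h n ω).trans_eq ?_
          simp only [abs_sub_comm (u _), abs_sub_comm (alphanj P X n _ (u _) ω),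
            abs_of_nonneg (sub_nonneg.2 (h _))]
      have h2 (k : Fin d) : |alphanj P X n k (u k) ω - alphanj P X n k (v k) ω| +
            Real.sqrt n * |u k - v k| ≤ (M + 1) * s ^ a := by
        have h3 : Real.sqrt n * |u k - v k| ≤ s ^ a :=
          (mul_le_mul_of_nonneg_left (hdist k) (Real.sqrt_nonneg _)).trans
            (sqrt_mul_le_rpow hg hs1 hns ha)
        have h4 : |alphanj P X n k (u k) ω - alphanj P X n k (v k) ω| ≤ M * s ^ a := by
          rcases hvk k with hk | hk
          · rw [hk, sub_self, abs_zero]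
            positivity
          rw [alphanj_eq_zero hn hω hk, sub_zero]
          rcases (hu k).2.eq_or_lt with h | h
          · rw [alphanj_eq_zero hn hω (Or.inr h), abs_zero]
            positivity
          have h5 : u k * (1 - u k) ≤ s := by
            refine le_trans ?_ (hdist k)
            rcases hk with hk | hk
            · rw [hk, sub_zero, abs_of_pos (hpos k)]
              nlinarith [hpos k]
            · rw [hk, abs_sub_comm, abs_of_pos (sub_pos.2 h)]
              nlinarith [hpos k]
          refine (hmarg k _ ⟨hpos k, h⟩).trans (mul_le_mul_of_nonneg_left ?_ hM)
          exact Real.rpow_le_rpow (mul_pos (hpos k) (sub_pos.2 h)).le h5 (hw.trans hwa).le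
        linarith
      have h3 := h1.trans (Finset.sum_le_card_nsmul _ _ _ fun k _ => h2 k)
      simp only [Finset.card_univ, Fintype.card_fin, nsmul_eq_mul] at h3
      have : 0 ≤ ε * s ^ w := by positivity
      linarith
  have hterm (k : Fin d) : |(Cdot (cop P X) k u - c k) * alphanj P X n k (u k) ω| ≤
      M * (A + 2) * s ^ a := by
    rcases (hu k).2.eq_or_lt with h | h
    · rw [alphanj_eq_zero hn hω (Or.inr h), mul_zero, abs_zero]
      positivity
    have h1 := mul_rpow_le_of_mul_le hg (mul_pos (hpos k) (sub_pos.2 h)) (hw.trans hwa).le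
      (by linarith) hA.le (hcoef k h).1 (hcoef k h).2
    rw [abs_mul]
    calc _ ≤ |Cdot (cop P X) k u - c k| * (M * (u k * (1 - u k)) ^ a) :=
          mul_le_mul_of_nonneg_left (hmarg k _ ⟨hpos k, h⟩) (abs_nonneg _)
      _ = M * (|Cdot (cop P X) k u - c k| * (u k * (1 - u k)) ^ a) := by ring
      _ ≤ M * ((A + 2) * s ^ a) := mul_le_mul_of_nonneg_left h1 hM
      _ = _ := by ring
  have hCbar : Cbar P X n u ω = (alphan P X n u ω - alphan P X n v ω) -
      ∑ k, (Cdot (cop P X) k u - c k) * alphanj P X n k (u k) ω := by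
    have (k : Fin d) : alphan P X n (Function.update (fun _ => (1 : ℝ)) k (u k)) ω =
        alphanj P X n k (u k) ω := alphan_update_one hmeas hstat hcont n k (hu k) ω
    simp only [Cbar, this, hlin n ω hω, sub_mul, Finset.sum_sub_distrib]
    ring
  have hsum : |∑ k, (Cdot (cop P X) k u - c k) * alphanj P X n k (u k) ω| ≤
      d * (M * (A + 2) * s ^ a) := by
    refine (Finset.abs_sum_le_sum_abs _ _).trans
      ((Finset.sum_le_card_nsmul _ _ _ fun k _ => hterm k).trans_eq (by simp))
  have hpow : s ^ a ≤ δ ^ (a - w) * s ^ w := by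
    calc s ^ a = s ^ (a - w) * s ^ w := by rw [← Real.rpow_add hg]; ring_nf
      _ ≤ _ := by gcongr
  rw [abs_div, gW, ← hs, abs_of_pos hsw, div_le_iff₀ hsw, hCbar]
  refine (abs_sub _ _).trans ((add_le_add hinc hsum).trans ?_)
  have hB : 0 ≤ d * (M + 1) + d * (M * (A + 2)) := by positivity
  nlinarith [mul_le_mul_of_nonneg_left hpow hB]

end Estimate

section Supremum

lemma le_biSup_of_bounded {ι : Type*} {S : Set ι} {f : ι → ℝ} {B : ℝ} (hB : 0 ≤ B)
    (hf : ∀ s ∈ S, f s ≤ B) {s : ι} (hs : s ∈ S) : f s ≤ ⨆ s ∈ S, f s := by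
  have hbdd : BddAbove (range fun s => ⨆ _ : s ∈ S, f s) :=
    ⟨B, forall_mem_range.2 fun s => Real.iSup_le (fun h => hf s h) hB⟩
  simpa [hs] using le_ciSup hbdd s

variable {P : Measure Ω} {X : ℤ → Ω → Fin d → ℝ}

lemma abs_alphan_sub_le_Mn_mul [IsProbabilityMeasure P] {n : ℕ} (hn : n ≠ 0) {δ μ : ℝ} (ω : Ω)
    {p q : Fin d → ℝ} (hp : p ∈ Icc 0 1) (hq : q ∈ Icc 0 1) (hpq : dist p q ≤ δ) :
    |alphan P X n p ω - alphan P X n q ω| ≤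
      Mn P X n δ μ ω * max (dist p q ^ μ) ((n : ℝ) ^ (-μ)) := by
  have hn' : 0 < (n : ℝ) ^ (-μ) := Real.rpow_pos_of_pos (by positivity) _
  rw [← div_le_iff₀ (lt_max_of_lt_right hn')]
  refine le_biSup_of_bounded (f := fun r : (Fin d → ℝ) × (Fin d → ℝ) =>
    |alphan P X n r.1 ω - alphan P X n r.2 ω| / max (dist r.1 r.2 ^ μ) ((n : ℝ) ^ (-μ)))
    (B := (Real.sqrt n + Real.sqrt n) / (n : ℝ) ^ (-μ)) (by positivity) (fun r _ => ?_)
    (s := (p, q)) ⟨hp, hq, hpq⟩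
  refine div_le_div₀ (by positivity) ?_ hn' (le_max_right _ _)
  exact (abs_sub _ _).trans (add_le_add (abs_alphan_le n _ ω) (abs_alphan_le n _ ω))

lemma abs_alphanj_le_biSup_mul {n : ℕ} (hn : n ≠ 0) {ω : Ω}
    (hω : ∀ i j, Uv P X i ω j ∈ Ioo (0 : ℝ) 1) {a : ℝ} (ha : a ≤ 1) (j : Fin d)
    {s : ℝ} (hs : s ∈ Ioo (0 : ℝ) 1) :
    |alphanj P X n j s ω| ≤
      (⨆ s ∈ Ioo (0 : ℝ) 1, |alphanj P X n j s ω| / (s * (1 - s)) ^ a) * (s * (1 - s)) ^ a := by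
  have hpos {t : ℝ} (ht : t ∈ Ioo (0 : ℝ) 1) : 0 < t * (1 - t) :=
    mul_pos ht.1 (sub_pos.2 ht.2)
  rw [← div_le_iff₀ (Real.rpow_pos_of_pos (hpos hs) a)]
  obtain ⟨B, hB0, hB⟩ := exists_abs_alphanj_le hn hω j
  refine le_biSup_of_bounded (f := fun s => |alphanj P X n j s ω| / (s * (1 - s)) ^ a) hB0
    (fun t ht => ?_) hs
  rw [div_le_iff₀ (Real.rpow_pos_of_pos (hpos ht) a)]
  refine (hB t ⟨ht.1.le, ht.2.le⟩).trans (mul_le_mul_of_nonneg_left ?_ hB0)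
  exact Real.self_le_rpow_of_le_one (hpos ht).le (by nlinarith [ht.1, ht.2]) ha

end Supremum

lemma div_two_mul_one_sub_le {θ : ℝ} (hθ : θ ∈ Ioc (0 : ℝ) (1 / 2)) : θ / (2 * (1 - θ)) ≤ θ :=
  div_le_self hθ.1.le (by linarith [hθ.2])

/-- Lemma 4.9: the weighted process `C̄_n/g_ω` is uniformly negligible on the
boundary region `N(0, δ_n)`. -/
theorem weighted_Cbar_negligible_near_boundary
    {Ω : Type*} [MeasurableSpace Ω] {d : ℕ} (hd : 2 ≤ d)
    (P : Measure Ω) [IsProbabilityMeasure P] (X : ℤ → Ω → Fin d → ℝ)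
    (hmeas : ∀ i, Measurable (X i)) (hstat : StrictlyStationary P X)
    (hcont : ∀ j, Continuous (margF P X j))
    (θ₁ θ₂ θ₃ : ℝ) (hθ₁ : θ₁ ∈ Set.Ioc (0 : ℝ) (1/2)) (hθ₂ : θ₂ ∈ Set.Ioc (0 : ℝ) (1/2))
    (hθ₃ : θ₃ ∈ Set.Ioc (1/2 : ℝ) 1)
    (hC : Condition21 (cop P X)) (h41 : Condition41 P X θ₁) (h43 : Condition43 P X θ₂ θ₃) :
    ∀ w ∈ Set.Ioo (0 : ℝ) (min (θ₁ / (2 * (1 - θ₁))) (min (θ₂ / (2 * (1 - θ₂))) (θ₃ - 1/2))),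
      ∀ δ : ℕ → ℝ, Antitone δ → Tendsto δ atTop (nhds 0) →
        oP1 P (fun n ω => ⨆ u ∈ NN d 0 (δ n), |Cbar P X n u ω / gW w u|) := by
  intro w hw δ _ hδ ε hε
  obtain ⟨a, hwa, haθ⟩ := exists_between ((hw.2.trans_le
    ((min_le_right _ _).trans (min_le_left _ _))).trans_le (div_two_mul_one_sub_le hθ₂))
  obtain ⟨μ, hwμ, hμθ⟩ := exists_between
    ((hw.2.trans_le (min_le_left _ _)).trans_le (div_two_mul_one_sub_le hθ₁))
  have ha : a ≤ 1 / 2 := haθ.le.trans hθ₂.2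
  rw [ENNReal.tendsto_nhds_zero]
  intro η hη
  obtain ⟨r, -, hr0, hrη⟩ := ENNReal.lt_iff_exists_real_btwn.1 hη
  have hr : 0 < r := ENNReal.ofReal_pos.1 hr0
  have hmarg (j : Fin d) := (h43 a ⟨hw.1.trans hwa, haθ⟩ (θ₃ / 2)
    ⟨by linarith [hθ₃.1], by linarith [hθ₃.1]⟩ j).1 (r / (d + 1)) (by positivity)
  choose M hM using hmarg
  obtain ⟨L, hL⟩ := (finite_range M).bddAbove
  obtain ⟨B, hB0, hB⟩ := exists_abs_Cbar_div_le (by omega) hmeas hstat hcont hC hw.1 hwa ha hwμ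
    (le_max_right L 0)
  have hsmall : ∀ᶠ n in atTop, B * δ n ^ (a - w) < ε / 2 := by
    have h := (hδ.rpow_const (p := a - w) (Or.inr (sub_pos.2 hwa).le)).const_mul B
    rw [Real.zero_rpow (sub_pos.2 hwa).ne', mul_zero] at h
    exact h.eventually (gt_mem_nhds (half_pos hε))
  have hmod := (ENNReal.tendsto_nhds_zero.1
    (h41 μ ⟨hw.1.trans hwμ, hμθ⟩ δ hδ (ε / 2) (half_pos hε))) (ENNReal.ofReal (r / (d + 1)))
    (ENNReal.ofReal_pos.2 (by positivity))
  filter_upwards [hsmall, hmod, eventually_all.2 hM, eventually_ne_atTop 0]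
    with n hn1 hn2 hn3 hn4
  have hsub : {ω | ε * 1 < |⨆ u ∈ NN d 0 (δ n), (|Cbar P X n u ω / gW w u|)|} ⊆
      {ω | ¬ ∀ i j, Uv P X i ω j ∈ Ioo (0 : ℝ) 1} ∪
        ({ω | ε / 2 * 1 < |Mn P X n (δ n) μ ω|} ∪ ⋃ j, {ω | M j <
          |⨆ s ∈ Ioo (0 : ℝ) 1, (|alphanj P X n j s ω| / (s * (1 - s)) ^ a)|}) := by
    intro ω hω
    by_contra hbad
    simp only [mem_union, mem_iUnion, mem_ofPred_eq, not_or, not_not, not_exists, not_lt,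
      mul_one] at hbad hω
    obtain ⟨hU, hmodω, hmargω⟩ := hbad
    have hle : ∀ u ∈ NN d 0 (δ n), |Cbar P X n u ω / gW w u| ≤ ε := fun u hu => by
      refine (hB n (δ n) (ε / 2) ω hn4 (half_pos hε).le hU (fun j s hs => ?_)
        (fun p q hp hq hpq => ?_) u hu).trans (by linarith)
      · refine (abs_alphanj_le_biSup_mul hn4 hU (by linarith : a ≤ 1) j hs).trans ?_
        refine mul_le_mul_of_nonneg_right ?_
          (Real.rpow_nonneg (mul_pos hs.1 (sub_pos.2 hs.2)).le a)
        exact (le_abs_self _).trans ((hmargω j).trans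
          ((hL (mem_range_self j)).trans (le_max_left _ _)))
      · refine (abs_alphan_sub_le_Mn_mul hn4 ω hp hq hpq).trans
          (mul_le_mul_of_nonneg_right ((le_abs_self _).trans hmodω) ?_)
        exact le_max_of_le_right (by positivity)
    refine absurd hω (not_lt.2 ?_)
    rw [abs_of_nonneg (Real.iSup_nonneg fun u => Real.iSup_nonneg fun _ => abs_nonneg _)]
    exact Real.iSup_le (fun u => Real.iSup_le (hle u) hε.le) hε.le
  have h0 : P {ω | ¬ ∀ i j, Uv P X i ω j ∈ Ioo (0 : ℝ) 1} = 0 :=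
    ae_iff.1 (ae_Uv_mem_Ioo hmeas hstat hcont)
  refine (measure_mono hsub).trans ((measure_union_le _ _).trans ?_)
  rw [h0, zero_add]
  refine (measure_union_le _ _).trans ((add_le_add hn2
    ((measure_iUnion_fintype_le _ _).trans (Finset.sum_le_sum fun j _ => hn3 j))).trans ?_)
  refine le_trans (le_of_eq ?_) hrη.le
  rw [Finset.sum_const, Finset.card_univ, Fintype.card_fin, ← ENNReal.ofReal_nsmul,
    ← ENNReal.ofReal_add (by positivity) (by positivity), nsmul_eq_mul]
  congr 1
  field_simp
  ring

end BBV
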